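/- Let F denote the subgroup of B_{m+n} generated by the elements a_{1,m+n}, a_{2,m+n}, …, a_{m+n−1,m+n}. Then F is a normal subgroup of P_{m,n}. -/

import Mathlib

open FreeGroup

namespace BraidPaper

/-- Relators for the Artin braid group on generators `σ_1, …, σ_n`
(so this presents the braid group `B_{n+1}`); the generator with index `k : Fin n`
represents `σ_{k+1}`. -/
def braidRels (n : ℕ) : Set (FreeGroup (Fin n)) :=
  {x | ∃ k l : Fin n, ((k : ℕ) + 2 ≤ (l : ℕ) ∨ (l : ℕ) + 2 ≤ (k : ℕ)) ∧
      x = of k * of l * (of k)⁻¹ * (of l)⁻¹} ∪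
  {x | ∃ k l : Fin n, (l : ℕ) = (k : ℕ) + 1 ∧
      x = of k * of l * of k * (of l)⁻¹ * (of k)⁻¹ * (of l)⁻¹}

/-- The braid group with `n` generators `σ_1, …, σ_n`, i.e. the Artin braid group
`B_{n+1}`.  Thus `B_N = BraidGroup (N-1)`. -/
abbrev BraidGroup (n : ℕ) : Type := PresentedGroup (braidRels n)

/-- The generator `σ_k` (1-based) of `BraidGroup n`, for `1 ≤ k ≤ n`. -/
def sgen (n k : ℕ) : BraidGroup n :=
  if h : 1 ≤ k ∧ k ≤ n then PresentedGroup.of ⟨k - 1, by omega⟩ else 1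

/-- The descending product `σ_{j-1} σ_{j-2} ⋯ σ_{i+1}`. -/
def dprod (n i j : ℕ) : BraidGroup n :=
  ((List.range (j - 1 - i)).map fun t => sgen n (j - 1 - t)).prod

/-- The pure braid generator
`a_{ij} = σ_{j-1} σ_{j-2} ⋯ σ_{i+1} σ_i² σ_{i+1}⁻¹ ⋯ σ_{j-2}⁻¹ σ_{j-1}⁻¹`. -/
def agen (n i j : ℕ) : BraidGroup n := dprod n i j * (sgen n i) ^ 2 * (dprod n i j)⁻¹
/-- The generating set of the mixed braid group `B_{m,n} ≤ B_{m+n}`: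
the pure generators `a_{ij}` with `1 ≤ i < j`, `m+1 ≤ j ≤ m+n`, together with
the crossings `σ_{m+1}, …, σ_{m+n-1}` among the last `n` strands. -/
def BmnSet (m n : ℕ) : Set (BraidGroup (m + n - 1)) :=
  {x | ∃ i j : ℕ, 1 ≤ i ∧ i < j ∧ m + 1 ≤ j ∧ j ≤ m + n ∧ x = agen (m + n - 1) i j} ∪
  {x | ∃ k : ℕ, m + 1 ≤ k ∧ k ≤ m + n - 1 ∧ x = sgen (m + n - 1) k}

/-- The mixed braid group `B_{m,n}`, as a subgroup of `B_{m+n}`. -/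
def Bmn (m n : ℕ) : Subgroup (BraidGroup (m + n - 1)) := Subgroup.closure (BmnSet m n)
theorem sgen_comm (n : ℕ) {k l : ℕ} (h : k + 2 ≤ l) : Commute (sgen n k) (sgen n l) := by
  unfold sgen
  split_ifs with hk hl
  · have hr : (PresentedGroup.mk (braidRels n))
        (of (⟨k - 1, by omega⟩ : Fin n) * of (⟨l - 1, by omega⟩ : Fin n) *
          (of (⟨k - 1, by omega⟩ : Fin n))⁻¹ * (of (⟨l - 1, by omega⟩ : Fin n))⁻¹) = 1 :=
      PresentedGroup.one_of_mem (Or.inl ⟨_, _, Or.inl (by simp only; omega), rfl⟩)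
    rw [← commutatorElement_def, map_commutatorElement, commutatorElement_eq_one_iff_commute] at hr
    exact hr
  · exact Commute.one_right _
  · exact Commute.one_left _
  · exact Commute.one_left _

theorem sgen_braid (n : ℕ) {k : ℕ} (h1 : 1 ≤ k) (h2 : k + 1 ≤ n) :
    sgen n k * sgen n (k + 1) * sgen n k = sgen n (k + 1) * sgen n k * sgen n (k + 1) := by
  have hk : 1 ≤ k ∧ k ≤ n := by omega
  have hl : 1 ≤ k + 1 ∧ k + 1 ≤ n := by omega
  simp only [sgen, dif_pos hk, dif_pos hl]
  have hr := PresentedGroup.one_of_mem (rels := braidRels n)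
    (Or.inr ⟨⟨k - 1, by omega⟩, ⟨k + 1 - 1, by omega⟩, by simp only; omega, rfl⟩)
  simp only [_root_.map_mul, _root_.map_inv] at hr
  rw [mul_inv_eq_one, mul_inv_eq_iff_eq_mul, mul_inv_eq_iff_eq_mul] at hr
  exact hr

theorem dprod_self_succ (n : ℕ) : dprod n n (n + 1) = 1 := by simp [dprod]

theorem dprod_step (n : ℕ) {j : ℕ} (h : j < n) :
    dprod n j (n + 1) = dprod n (j + 1) (n + 1) * sgen n (j + 1) := by
  have e : n + 1 - 1 - j = (n + 1 - 1 - (j + 1)) + 1 := by omega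
  have e' : n + 1 - 1 - (n + 1 - 1 - (j + 1)) = j + 1 := by omega
  unfold dprod
  rw [e, List.range_succ, List.map_append, List.prod_append, List.map_singleton,
    List.prod_singleton, e']

theorem commute_sgen_dprod (n : ℕ) {k j : ℕ} (h : k < j) :
    Commute (sgen n k) (dprod n j (n + 1)) := by
  apply Commute.list_prod_right
  intro x hx
  simp only [List.mem_map, List.mem_range] at hx
  obtain ⟨t, ht, rfl⟩ := hx
  exact sgen_comm n (by omega)

theorem dprod_mul_sgen (n : ℕ) {k j : ℕ} (hj : j ≤ n) (h : j < k) (hk : k < n) :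
    dprod n j (n + 1) * sgen n (k + 1) = sgen n k * dprod n j (n + 1) := by
  induction hj using Nat.decreasingInduction with
  | self => omega
  | of_succ j hj ih =>
    rcases (Nat.succ_le_of_lt h).eq_or_lt with rfl | h'
    · rw [dprod_step n hj, dprod_step n hk, mul_assoc, mul_assoc, ← mul_assoc (sgen n (j + 1 + 1)),
        ← sgen_braid n (by omega) hk, ← mul_assoc, ← mul_assoc,
        ← (commute_sgen_dprod n (Nat.lt_succ_self (j + 1))).eq]
      simp only [mul_assoc]
    · rw [dprod_step n hj, mul_assoc, (sgen_comm n (by omega : j + 1 + 2 ≤ k + 1)).eq, ← mul_assoc,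
        ih h', mul_assoc]

theorem commute_sgen_agen_of_lt (n : ℕ) {k i : ℕ} (h : k + 1 < i) :
    Commute (sgen n k) (agen n i (n + 1)) := by
  have h1 := commute_sgen_dprod n (by omega : k < i)
  exact (h1.mul_right ((sgen_comm n h).pow_right 2)).mul_right h1.inv_right

theorem commute_sgen_agen_of_gt (n : ℕ) {k i : ℕ} (h : i < k) (hk : k < n) :
    Commute (sgen n k) (agen n i (n + 1)) := by
  have h1 : SemiconjBy (dprod n i (n + 1)) (sgen n (k + 1)) (sgen n k) :=
    dprod_mul_sgen n (by omega) h hk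
  have h2 : Commute (sgen n (k + 1)) (sgen n i ^ 2) :=
    ((sgen_comm n (by omega : i + 2 ≤ k + 1)).pow_left 2).symm
  have h3 : SemiconjBy (dprod n i (n + 1) * sgen n i ^ 2 * (dprod n i (n + 1))⁻¹)
      (sgen n k) (sgen n k) :=
    (h1.mul_left h2.symm).mul_left h1.inv_symm_left
  exact Commute.symm h3

theorem braid_conj_sq {G : Type*} [Group G] {x y : G} (h : x * y * x = y * x * y) :
    x * (y * x ^ 2 * y⁻¹) * x⁻¹ = y ^ 2 := by
  have h1 : x * y * x * (x * y)⁻¹ = y := by rw [h, mul_assoc y, mul_inv_cancel_right]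
  calc x * (y * x ^ 2 * y⁻¹) * x⁻¹
      = (x * y * x * (x * y)⁻¹) * (x * y * x * (x * y)⁻¹) := by simp [pow_two, mul_assoc]
    _ = y ^ 2 := by rw [h1, pow_two]

theorem braid_conj_sq' {G : Type*} [Group G] {x y : G} (h : x * y * x = y * x * y) :
    x * y ^ 2 * x⁻¹ = (y ^ 2)⁻¹ * (y * x ^ 2 * y⁻¹) * y ^ 2 := by
  have h1 : x * y * x⁻¹ = y⁻¹ * x * y := by
    rw [mul_inv_eq_iff_eq_mul, mul_assoc, mul_assoc, eq_inv_mul_iff_mul_eq, ← mul_assoc,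
      ← mul_assoc, ← h]
  calc x * y ^ 2 * x⁻¹ = (x * y * x⁻¹) * (x * y * x⁻¹) := by simp [pow_two, mul_assoc]
    _ = (y⁻¹ * x * y) * (y⁻¹ * x * y) := by rw [h1]
    _ = _ := by simp [pow_two, mul_assoc]

theorem inv_conj_eq {G : Type*} [Group G] {s a b : G} (h1 : s * a * s⁻¹ = b)
    (h2 : s * b * s⁻¹ = b⁻¹ * a * b) : s⁻¹ * a * s = a * b * a⁻¹ := by
  have h3 : s⁻¹ * b * s = a := by rw [← h1]; group
  have h4 : a = b * (s * b * s⁻¹) * b⁻¹ := by rw [h2]; group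
  calc s⁻¹ * a * s = (s⁻¹ * b * s) * b * (s⁻¹ * b * s)⁻¹ := by rw [h4]; group
    _ = a * b * a⁻¹ := by rw [h3]

theorem agen_eq_conj_dprod_succ (n : ℕ) {i : ℕ} (h : i < n) :
    agen n i (n + 1) = MulAut.conj (dprod n (i + 1) (n + 1))
      (sgen n (i + 1) * sgen n i ^ 2 * (sgen n (i + 1))⁻¹) := by
  rw [agen, dprod_step n h, MulAut.conj_apply]
  group

theorem agen_succ_eq_conj_dprod (n i : ℕ) :
    agen n (i + 1) (n + 1) = MulAut.conj (dprod n (i + 1) (n + 1)) (sgen n (i + 1) ^ 2) := rfl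

theorem conj_dprod_sgen (n i : ℕ) :
    MulAut.conj (dprod n (i + 1) (n + 1)) (sgen n i) = sgen n i := by
  rw [MulAut.conj_apply, ← (commute_sgen_dprod n (Nat.lt_succ_self i)).eq, mul_inv_cancel_right]

theorem sgen_conj_agen (n : ℕ) {i : ℕ} (h1 : 1 ≤ i) (h : i < n) :
    sgen n i * agen n i (n + 1) * (sgen n i)⁻¹ = agen n (i + 1) (n + 1) := by
  rw [agen_succ_eq_conj_dprod, ← braid_conj_sq (sgen_braid n h1 h), _root_.map_mul,
    _root_.map_mul, _root_.map_inv, conj_dprod_sgen, agen_eq_conj_dprod_succ n h]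

theorem sgen_conj_agen_succ (n : ℕ) {i : ℕ} (h1 : 1 ≤ i) (h : i < n) :
    sgen n i * agen n (i + 1) (n + 1) * (sgen n i)⁻¹ =
      (agen n (i + 1) (n + 1))⁻¹ * agen n i (n + 1) * agen n (i + 1) (n + 1) := by
  rw [agen_succ_eq_conj_dprod, agen_eq_conj_dprod_succ n h, ← _root_.map_inv, ← _root_.map_mul, ← _root_.map_mul,
    ← braid_conj_sq' (sgen_braid n h1 h), _root_.map_mul, _root_.map_mul, _root_.map_inv, conj_dprod_sgen]

/-- The subgroup generated by `a_{1,n+1}, …, a_{n,n+1}` in `B_{n+1}`. -/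
def lastStrand (n : ℕ) : Subgroup (BraidGroup n) :=
  Subgroup.closure {x | ∃ i : ℕ, 1 ≤ i ∧ i ≤ n ∧ x = agen n i (n + 1)}

theorem agen_mem_lastStrand {n i : ℕ} (h1 : 1 ≤ i) (h : i ≤ n) :
    agen n i (n + 1) ∈ lastStrand n :=
  Subgroup.subset_closure ⟨i, h1, h, rfl⟩

theorem mem_normalizer_closure {G : Type*} [Group G] {S : Set G} {g : G}
    (h : ∀ s ∈ S, g * s * g⁻¹ ∈ Subgroup.closure S)
    (h' : ∀ s ∈ S, g⁻¹ * s * g ∈ Subgroup.closure S) :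
    g ∈ Subgroup.normalizer (Subgroup.closure S : Set G) := by
  have key : ∀ k : G, (∀ s ∈ S, k * s * k⁻¹ ∈ Subgroup.closure S) →
      ∀ x ∈ Subgroup.closure S, k * x * k⁻¹ ∈ Subgroup.closure S := fun k hk x hx => by
    have : Subgroup.closure S ≤ (Subgroup.closure S).comap (MulAut.conj k).toMonoidHom :=
      (Subgroup.closure_le _).2 hk
    exact this hx
  rw [Subgroup.mem_normalizer_iff]
  refine fun x => ⟨key g h x, fun hx => ?_⟩
  have := key g⁻¹ (by simpa using h') _ hx
  simpa [mul_assoc] using this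

theorem sgen_mem_normalizer (n : ℕ) {k : ℕ} (h1 : 1 ≤ k) (hk : k < n) :
    sgen n k ∈ Subgroup.normalizer (lastStrand n : Set (BraidGroup n)) := by
  have hc : ∀ i, 1 ≤ i → i ≤ n → Commute (sgen n k) (agen n i (n + 1)) →
      sgen n k * agen n i (n + 1) * (sgen n k)⁻¹ ∈ lastStrand n ∧
      (sgen n k)⁻¹ * agen n i (n + 1) * sgen n k ∈ lastStrand n := fun i hi1 hi hc => by
    rw [hc.eq, mul_inv_cancel_right, mul_assoc, ← hc.eq, inv_mul_cancel_left, and_self]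
    exact agen_mem_lastStrand hi1 hi
  have m1 : agen n k (n + 1) ∈ lastStrand n := agen_mem_lastStrand h1 hk.le
  have m2 : agen n (k + 1) (n + 1) ∈ lastStrand n := agen_mem_lastStrand (by omega) hk
  have e1 := sgen_conj_agen n h1 hk
  have e2 := sgen_conj_agen_succ n h1 hk
  have main : ∀ i, 1 ≤ i → i ≤ n →
      sgen n k * agen n i (n + 1) * (sgen n k)⁻¹ ∈ lastStrand n ∧
      (sgen n k)⁻¹ * agen n i (n + 1) * sgen n k ∈ lastStrand n := fun i hi1 hi => by
    obtain h | rfl | rfl | h : i < k ∨ i = k ∨ i = k + 1 ∨ k + 1 < i := by omega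
    · exact hc i hi1 hi (commute_sgen_agen_of_gt n h hk)
    · refine ⟨e1 ▸ m2, ?_⟩
      have e3 : (sgen n i)⁻¹ * agen n i (n + 1) * sgen n i =
          agen n i (n + 1) * agen n (i + 1) (n + 1) * (agen n i (n + 1))⁻¹ :=
        inv_conj_eq e1 e2
      rw [e3]
      exact mul_mem (mul_mem m1 m2) (inv_mem m1)
    · refine ⟨e2 ▸ mul_mem (mul_mem (inv_mem m2) m1) m2, ?_⟩
      rw [← e1]
      simpa [mul_assoc] using m1
    · exact hc i hi1 hi (commute_sgen_agen_of_lt n h)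
  refine mem_normalizer_closure ?_ ?_
  · rintro _ ⟨i, hi1, hi, rfl⟩
    exact (main i hi1 hi).1
  · rintro _ ⟨i, hi1, hi, rfl⟩
    exact (main i hi1 hi).2

theorem dprod_mul_sgen_self (n : ℕ) {j : ℕ} (h : j < n) :
    dprod n j (n + 1) * sgen n (j + 1) = agen n (j + 1) (n + 1) * dprod n (j + 1) (n + 1) := by
  rw [dprod_step n h, agen, inv_mul_cancel_right, pow_two, mul_assoc]

/-- Every braid lies in a coset `K σ_n σ_{n-1} ⋯ σ_{j+1}` of a subgroup `K` containing
`σ_1, …, σ_{n-1}` and all the `a_{i,n+1}`. -/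
theorem exists_mul_dprod (n : ℕ) (K : Subgroup (BraidGroup n))
    (hs : ∀ k, 1 ≤ k → k < n → sgen n k ∈ K)
    (ha : ∀ i, 1 ≤ i → i ≤ n → agen n i (n + 1) ∈ K) (g : BraidGroup n) :
    ∃ j ≤ n, ∃ h ∈ K, g = h * dprod n j (n + 1) := by
  have hg : g ∈ Subgroup.closure (Set.range (PresentedGroup.of (rels := braidRels n))) := by
    rw [PresentedGroup.closure_range_of]; trivial
  have hof : ∀ k : Fin n, PresentedGroup.of k = sgen n (k + 1) := fun k => by
    have : 1 ≤ (k : ℕ) + 1 ∧ (k : ℕ) + 1 ≤ n := by omega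
    simp only [sgen, dif_pos this]
    rfl
  induction hg using Subgroup.closure_induction_right with
  | one => exact ⟨n, le_rfl, 1, K.one_mem, by rw [dprod_self_succ, one_mul]⟩
  | mul_right x _ y hy ih =>
    obtain ⟨⟨k, hk⟩, rfl⟩ := hy
    obtain ⟨j, hj, h, hh, rfl⟩ := ih
    rw [hof]
    obtain hlt | rfl | rfl | hgt : k + 1 < j ∨ j = k + 1 ∨ j = k ∨ j < k := by omega
    · exact ⟨j, hj, h * sgen n (k + 1), mul_mem hh (hs _ (by omega) (by omega)), by
        rw [mul_assoc, mul_assoc, (commute_sgen_dprod n hlt).eq]⟩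
    · exact ⟨k, hk.le, h, hh, by rw [dprod_step n hk, mul_assoc]⟩
    · exact ⟨j + 1, hk, h * agen n (j + 1) (n + 1), mul_mem hh (ha _ (by omega) hk), by
        rw [mul_assoc, mul_assoc, dprod_mul_sgen_self n hk]⟩
    · exact ⟨j, hj, h * sgen n k, mul_mem hh (hs _ (by omega) hk), by
        rw [mul_assoc, mul_assoc, dprod_mul_sgen n hj hgt hk]⟩
  | mul_inv_cancel x _ y hy ih =>
    obtain ⟨⟨k, hk⟩, rfl⟩ := hy
    obtain ⟨j, hj, h, hh, rfl⟩ := ih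
    rw [hof]
    obtain hlt | rfl | rfl | hgt : k + 1 < j ∨ j = k + 1 ∨ j = k ∨ j < k := by omega
    · exact ⟨j, hj, h * (sgen n (k + 1))⁻¹,
        mul_mem hh (inv_mem (hs _ (by omega) (by omega))), by
        rw [mul_assoc, mul_assoc, (commute_sgen_dprod n hlt).inv_left.eq]⟩
    · refine ⟨k, hk.le, h * (agen n (k + 1) (n + 1))⁻¹,
        mul_mem hh (inv_mem (ha _ (by omega) hk)), ?_⟩
      rw [mul_assoc, mul_assoc, mul_right_inj, mul_inv_eq_iff_eq_mul, mul_assoc,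
        dprod_mul_sgen_self n hk, inv_mul_cancel_left]
    · exact ⟨j + 1, hk, h, hh, by rw [dprod_step n hk]; group⟩
    · refine ⟨j, hj, h * (sgen n k)⁻¹, mul_mem hh (inv_mem (hs _ (by omega) hk)), ?_⟩
      rw [mul_assoc, mul_assoc, mul_right_inj, mul_inv_eq_iff_eq_mul, mul_assoc,
        dprod_mul_sgen n hj hgt hk, inv_mul_cancel_left]

theorem lastStrand_le_ker (n : ℕ) (π : BraidGroup n →* Equiv.Perm (Fin (n + 1)))
    (hπ : ∀ k (_ : 1 ≤ k) (_ : k ≤ n), π (sgen n k) =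
      Equiv.swap (⟨k - 1, by omega⟩ : Fin (n + 1)) (⟨k, by omega⟩ : Fin (n + 1))) :
    lastStrand n ≤ π.ker := by
  refine (Subgroup.closure_le _).2 ?_
  rintro _ ⟨i, hi1, hi, rfl⟩
  rw [SetLike.mem_coe, MonoidHom.mem_ker, agen, _root_.map_mul, _root_.map_mul, _root_.map_pow, hπ i hi1 hi, pow_two,
    Equiv.swap_mul_self, mul_one, _root_.map_inv, mul_inv_cancel]

theorem map_dprod_apply (n : ℕ) (π : BraidGroup n →* Equiv.Perm (Fin (n + 1)))
    (hπ : ∀ k (_ : 1 ≤ k) (_ : k ≤ n), π (sgen n k) =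
      Equiv.swap (⟨k - 1, by omega⟩ : Fin (n + 1)) (⟨k, by omega⟩ : Fin (n + 1)))
    {j : ℕ} (hj : j ≤ n) :
    π (dprod n j (n + 1)) ⟨j, by omega⟩ = Fin.last n := by
  induction hj using Nat.decreasingInduction with
  | self => rw [dprod_self_succ, _root_.map_one]; rfl
  | of_succ j hj ih =>
    rw [dprod_step n hj, _root_.map_mul, hπ (j + 1) (by omega) hj, Equiv.Perm.mul_apply]
    simp only [Nat.add_sub_cancel, Equiv.swap_apply_left]
    exact ih

theorem ker_le_normalizer (n : ℕ) (π : BraidGroup n →* Equiv.Perm (Fin (n + 1)))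
    (hπ : ∀ k (_ : 1 ≤ k) (_ : k ≤ n), π (sgen n k) =
      Equiv.swap (⟨k - 1, by omega⟩ : Fin (n + 1)) (⟨k, by omega⟩ : Fin (n + 1))) :
    π.ker ≤ Subgroup.normalizer (lastStrand n : Set (BraidGroup n)) := by
  intro g hg
  obtain ⟨j, hj, h, hh, rfl⟩ := exists_mul_dprod n
    (Subgroup.normalizer (lastStrand n : Set (BraidGroup n)) ⊓
      (MulAction.stabilizer (Equiv.Perm (Fin (n + 1))) (Fin.last n)).comap π)
    (fun k hk1 hk => ⟨sgen_mem_normalizer n hk1 hk, by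
      change π _ • Fin.last n = Fin.last n
      simp only [hπ k hk1 hk.le, Equiv.Perm.smul_def]
      apply Equiv.swap_apply_of_ne_of_ne <;> simp only [ne_eq, Fin.ext_iff, Fin.val_last] <;>
        omega⟩)
    (fun i hi1 hi => ⟨Subgroup.le_normalizer (agen_mem_lastStrand hi1 hi), by
      change π _ • Fin.last n = Fin.last n
      simp only [MonoidHom.mem_ker.1 (lastStrand_le_ker n π hπ (agen_mem_lastStrand hi1 hi)), one_smul]⟩) g
  have h1 := congrArg (fun p : Equiv.Perm (Fin (n + 1)) => p ⟨j, by omega⟩) (MonoidHom.mem_ker.1 hg)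
  have h2 : π h (Fin.last n) = Fin.last n := hh.2
  simp only [_root_.map_mul, Equiv.Perm.mul_apply, map_dprod_apply n π hπ hj, h2, Equiv.Perm.one_apply,
    Fin.ext_iff, Fin.val_last] at h1
  subst h1
  rw [dprod_self_succ, mul_one]
  exact hh.1

theorem lastStrand_le_ker_le_normalizer {n N : ℕ} (hN : N = n + 1)
    (π : BraidGroup n →* Equiv.Perm (Fin N))
    (hπ : ∀ k (_ : 1 ≤ k) (_ : k ≤ n), π (sgen n k) =
      Equiv.swap (⟨k - 1, by omega⟩ : Fin N) (⟨k, by omega⟩ : Fin N))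
    (F : Subgroup (BraidGroup n))
    (hF : F = Subgroup.closure {x | ∃ i : ℕ, 1 ≤ i ∧ i ≤ n ∧ x = agen n i N}) :
    F ≤ π.ker ∧ π.ker ≤ Subgroup.normalizer (F : Set (BraidGroup n)) := by
  subst hN hF
  exact ⟨lastStrand_le_ker n π hπ, ker_le_normalizer n π hπ⟩

/-- The subgroup `F` of `B_{m+n}` generated by `a_{1,m+n}, …, a_{m+n−1,m+n}` is a
normal subgroup of `P_{m,n} = B_{m,n} ⊓ ker π`. -/
theorem statement12 (m n : ℕ) (hm : 1 ≤ m) (hn : 1 ≤ n)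
    (π : BraidGroup (m + n - 1) →* Equiv.Perm (Fin (m + n)))
    (hπ : ∀ k : ℕ, ∀ _hk1 : 1 ≤ k, ∀ _hk2 : k ≤ m + n - 1,
      π (sgen (m + n - 1) k) =
        Equiv.swap (⟨k - 1, by omega⟩ : Fin (m + n)) (⟨k, by omega⟩ : Fin (m + n)))
    (F : Subgroup (BraidGroup (m + n - 1)))
    (hF : F = Subgroup.closure
      {x | ∃ i : ℕ, 1 ≤ i ∧ i ≤ m + n - 1 ∧ x = agen (m + n - 1) i (m + n)}) :
    F ≤ Bmn m n ⊓ π.ker ∧ (F.subgroupOf (Bmn m n ⊓ π.ker)).Normal := by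
  obtain ⟨hker, hnorm⟩ := lastStrand_le_ker_le_normalizer (by omega) π hπ F hF
  have hB : F ≤ Bmn m n := by
    rw [hF]
    refine Subgroup.closure_mono ?_
    rintro _ ⟨i, hi1, hi, rfl⟩
    exact Or.inl ⟨i, m + n, hi1, by omega, by omega, le_rfl, rfl⟩
  exact ⟨le_inf hB hker,
    Subgroup.normal_subgroupOf_of_le_normalizer (inf_le_right.trans hnorm)⟩

end BraidPaper
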